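/- Let F be a finite set of connected (unlabeled) graphs, let X be a finite set of labels, let Q be a (min_{H∈F}|V(H)|)-saturated set of connected X-labeled graphs, each on at most max_{H∈F}|E(H)| + 1 vertices, and let C be an X-labeled graph. If every optimal F-deletion set Y of C leaves a Q-minor (i.e., C − Y contains some member of Q as a labeled minor), then there exists a subset Q* ⊆ Q whose size is bounded by a function of F and td(C) alone (independent of |V(C)| and |X|), such that every optimal F-deletion set of C leaves a Q*-minor. -/

import Mathlib

namespace FDel

open scoped Classical

noncomputable section

/-- Reachability inside the vertex set `S` of a simple graph. -/
def ReachIn {V : Type*} (G : SimpleGraph V) (S : Set V) (a b : V) : Prop :=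
  Relation.ReflTransGen (fun u v => G.Adj u v ∧ u ∈ S ∧ v ∈ S) a b

/-- `C` is (the vertex set of) a connected component of the subgraph of `G` induced by `S`. -/
def IsCompOf {V : Type*} (G : SimpleGraph V) (S C : Set V) : Prop :=
  ∃ v ∈ S, C = {w | w ∈ S ∧ ReachIn G S v w}

/-- `tdLE G n S` expresses that the treedepth of the subgraph of `G` induced by `S` is at
most `n`: the empty graph has treedepth `0`, and `G[S]` has treedepth at most `n+1` iff from
every connected component one may delete a vertex leaving treedepth at most `n`. -/
def tdLE {V : Type*} (G : SimpleGraph V) : ℕ → Set V → Prop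
  | 0, S => S = ∅
  | n + 1, S => ∀ C, IsCompOf G S C → ∃ v ∈ C, tdLE G n (C \ {v})

/-- The treedepth of `G`. -/
def treedepth {V : Type*} (G : SimpleGraph V) : ℕ := sInf {n | tdLE G n Set.univ}

/-- A minor model of `H` in `G` whose branch sets are contained in `A`: nonempty, connected,
pairwise disjoint branch sets, with every edge of `H` realized between the branch sets. -/
structure IsMinorModelOn {W V : Type*} (H : SimpleGraph W) (G : SimpleGraph V)
    (A : Set V) (φ : W → Set V) : Prop where
  sub : ∀ w, φ w ⊆ A
  nonempty : ∀ w, (φ w).Nonempty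
  conn : ∀ w, ∀ a ∈ φ w, ∀ b ∈ φ w, ReachIn G (φ w) a b
  disj : ∀ w w', w ≠ w' → Disjoint (φ w) (φ w')
  edge : ∀ w w', H.Adj w w' → ∃ a ∈ φ w, ∃ b ∈ φ w', G.Adj a b

/-- A (finite) graph given abstractly, as a simple graph on `Fin n`. -/
structure FinGraph where
  n : ℕ
  adj : SimpleGraph (Fin n)

/-- `G` has `H` as a minor with all branch sets inside `A` (i.e. `G[A]` has an `H`-minor). -/
def HasMinorOn {V : Type*} (G : SimpleGraph V) (A : Set V) (H : FinGraph) : Prop :=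
  ∃ φ, IsMinorModelOn H.adj G A φ

/-- `Y` is an `F`-deletion set of `G[A]`: `Y ⊆ A` and `G[A ∖ Y]` has no `F`-minor. -/
def FDelSetOn {V : Type*} (F : Set FinGraph) (G : SimpleGraph V) (A Y : Set V) : Prop :=
  Y ⊆ A ∧ ∀ H ∈ F, ¬ HasMinorOn G (A \ Y) H

/-- The minimum size `opt_F(G[A])` of an `F`-deletion set of `G[A]`. -/
def optF {V : Type*} (F : Set FinGraph) (G : SimpleGraph V) (A : Set V) : ℕ :=
  sInf (Set.ncard '' {Y | FDelSetOn F G A Y})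

/-- `Y` is an optimal `F`-deletion set of `G`. -/
def IsOptFDel {V : Type*} (F : Set FinGraph) (G : SimpleGraph V) (Y : Set V) : Prop :=
  FDelSetOn F G Set.univ Y ∧ ∀ Y', FDelSetOn F G Set.univ Y' → Y.ncard ≤ Y'.ncard

/-- An `X`-labeled (finite) graph: a graph on `Fin n` whose vertices carry subsets of `X`
as labelsets. -/
structure LabGraph (X : Type) where
  n : ℕ
  adj : SimpleGraph (Fin n)
  lab : Fin n → Set X

/-- A labeled minor model of the `X`-labeled graph `H` in the graph `G` with vertex labels
`labG`, with all branch sets inside `A`: in addition to the minor-model conditions, every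
label of a vertex of `H` occurs on some vertex of its branch set. -/
structure IsLabMinorModelOn {X : Type} (H : LabGraph X) {V : Type*} (G : SimpleGraph V)
    (labG : V → Set X) (A : Set V) (φ : Fin H.n → Set V) : Prop where
  sub : ∀ w, φ w ⊆ A
  nonempty : ∀ w, (φ w).Nonempty
  conn : ∀ w, ∀ a ∈ φ w, ∀ b ∈ φ w, ReachIn G (φ w) a b
  disj : ∀ w w', w ≠ w' → Disjoint (φ w) (φ w')
  edge : ∀ w w', H.adj.Adj w w' → ∃ a ∈ φ w, ∃ b ∈ φ w', G.Adj a b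
  labels : ∀ w, ∀ x ∈ H.lab w, ∃ a ∈ φ w, x ∈ labG a

section Reach

variable {V : Type*} {G : SimpleGraph V} {S T : Set V} {a b c v : V}

theorem ReachIn.refl (a : V) : ReachIn G S a a := Relation.ReflTransGen.refl

theorem ReachIn.trans (h : ReachIn G S a b) (h' : ReachIn G S b c) : ReachIn G S a c :=
  Relation.ReflTransGen.trans h h'

theorem ReachIn.symm (h : ReachIn G S a b) : ReachIn G S b a := by
  induction h with
  | refl => exact ReachIn.refl _
  | tail _ h ih => exact Relation.ReflTransGen.head ⟨h.1.symm, h.2.2, h.2.1⟩ ih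

theorem ReachIn.mono (hST : S ⊆ T) (h : ReachIn G S a b) : ReachIn G T a b :=
  Relation.ReflTransGen.mono (fun _ _ h => ⟨h.1, hST h.2.1, hST h.2.2⟩) _ _ h

theorem ReachIn.mem (h : ReachIn G S a b) (ha : a ∈ S) : b ∈ S := by
  induction h with
  | refl => exact ha
  | tail _ h _ => exact h.2.2

theorem ReachIn.single (h : G.Adj a b) (ha : a ∈ S) (hb : b ∈ S) : ReachIn G S a b :=
  Relation.ReflTransGen.single ⟨h, ha, hb⟩

/-- The part of `S` reachable from `a` within `S` is connected. -/
theorem ReachIn.restrict (h : ReachIn G S a b) :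
    ReachIn G {x | x ∈ S ∧ ReachIn G S a x} a b := by
  induction h with
  | refl => exact ReachIn.refl _
  | @tail c d hac hcd ih =>
    exact ih.trans (ReachIn.single hcd.1 ⟨hcd.2.1, hac⟩ ⟨hcd.2.2, hac.tail hcd⟩)

theorem ReachIn.avoid_or (h : ReachIn G S a b) (ha : a ∈ S) (hav : a ≠ v) :
    ReachIn G (S \ {v}) a b ∨
      v ∈ S ∧ ∃ u ∈ S \ {v}, ReachIn G (S \ {v}) a u ∧ G.Adj u v := by
  induction h with
  | refl => exact Or.inl (ReachIn.refl _)
  | @tail c d _ hcd ih =>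
    rcases ih with ih | ih
    · have hc : c ∈ S \ {v} := ih.mem ⟨ha, hav⟩
      by_cases hd : d = v
      · subst hd
        exact Or.inr ⟨hcd.2.2, c, hc, ih, hcd.1⟩
      · exact Or.inl (ih.trans (ReachIn.single hcd.1 hc ⟨hcd.2.2, hd⟩))
    · exact Or.inr ih

theorem ReachIn.exists_adj (h : ReachIn G S a v) (ha : a ∈ S) (hav : a ≠ v) :
    v ∈ S ∧ ∃ u ∈ S \ {v}, ReachIn G (S \ {v}) a u ∧ G.Adj u v := by
  rcases h.avoid_or ha hav with h | h
  · exact absurd rfl (h.mem ⟨ha, hav⟩).2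
  · exact h

theorem ReachIn.map {W : Type*} {G' : SimpleGraph W} {U : Set V} {f : V → W} (hSU : S ⊆ U)
    (hf : ∀ u ∈ U, ∀ w ∈ U, G.Adj u w → G'.Adj (f u) (f w)) (h : ReachIn G S a b) :
    ReachIn G' (f '' S) (f a) (f b) := by
  induction h with
  | refl => exact ReachIn.refl _
  | tail _ h ih =>
    exact ih.trans (ReachIn.single (hf _ (hSU h.2.1) _ (hSU h.2.2) h.1)
      (Set.mem_image_of_mem _ h.2.1) (Set.mem_image_of_mem _ h.2.2))

/-- Any two vertices joined within a subset `B` of `A` are joined within a subset of `B` of size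
at most `c`. -/
def ShortReach (G : SimpleGraph V) (c : ℕ) (A : Set V) : Prop :=
  ∀ B ⊆ A, ∀ a ∈ B, ∀ b, ReachIn G B a b →
    ∃ U : Finset V, ↑U ⊆ B ∧ U.card ≤ c ∧ a ∈ U ∧ b ∈ U ∧ ∀ x ∈ U, ReachIn G ↑U a x

theorem ShortReach.insert {c : ℕ} {D : Set V} (h : ShortReach G c D) (v : V) :
    ShortReach G (2 * c + 2) (insert v D) := by
  intro B hB a ha b hab
  have hBD : B \ {v} ⊆ D := fun x hx => (hB hx.1).resolve_left hx.2
  have key : ∀ a ∈ B, ReachIn G B a v →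
      ∃ U : Finset V, ↑U ⊆ B ∧ U.card ≤ c + 1 ∧ a ∈ U ∧ v ∈ U ∧ ∀ x ∈ U, ReachIn G ↑U v x := by
    intro a ha hav
    by_cases e : a = v
    · subst e
      refine ⟨{a}, by simpa using ha, by simp, by simp, by simp, ?_⟩
      intro x hx
      rw [Finset.mem_singleton.1 hx]
      exact ReachIn.refl _
    · obtain ⟨hv, u, hu, hau, huv⟩ := hav.exists_adj ha e
      obtain ⟨U, hUB, hUc, haU, huU, hU⟩ := h _ hBD a ⟨ha, e⟩ u hau
      refine ⟨Insert.insert v U, ?_, (Finset.card_insert_le _ _).trans (by omega), by simp [haU],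
        by simp, ?_⟩
      · rw [Finset.coe_insert]
        exact Set.insert_subset hv (hUB.trans Set.sdiff_subset)
      · intro x hx
        rcases Finset.mem_insert.1 hx with rfl | hx
        · exact ReachIn.refl _
        · have hsub : (U : Set V) ⊆ ↑(Insert.insert v U) := by simp
          have h1 : ReachIn G (↑(Insert.insert v U) : Set V) v u :=
            ReachIn.single huv.symm (by simp) (hsub huU)
          exact h1.trans (((hU u huU).symm.trans (hU x hx)).mono hsub)
  have fin : ReachIn G B a v → ReachIn G B b v → ∃ U : Finset V, ↑U ⊆ B ∧ U.card ≤ 2 * c + 2 ∧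
      a ∈ U ∧ b ∈ U ∧ ∀ x ∈ U, ReachIn G ↑U a x := by
    intro h1 h2
    obtain ⟨U, hUB, hUc, haU, hvU, hU⟩ := key a ha h1
    obtain ⟨U', hUB', hUc', hbU', hvU', hU'⟩ := key b (hab.mem ha) h2
    refine ⟨U ∪ U', ?_, (Finset.card_union_le _ _).trans (by omega), by simp [haU], by simp [hbU'],
      ?_⟩
    · rw [Finset.coe_union]
      exact Set.union_subset hUB hUB'
    · have s1 : (U : Set V) ⊆ ↑(U ∪ U') := by simp
      have s2 : (U' : Set V) ⊆ ↑(U ∪ U') := by simp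
      intro x hx
      refine ((hU a haU).symm.mono s1).trans ?_
      rcases Finset.mem_union.1 hx with hx | hx
      · exact (hU x hx).mono s1
      · exact (hU' x hx).mono s2
  by_cases e : a = v
  · subst e
    exact fin (ReachIn.refl _) hab.symm
  · rcases hab.avoid_or (v := v) ha e with h1 | ⟨hv, u, hu, hau, huv⟩
    · obtain ⟨U, hUB, hUc, h2⟩ := h _ hBD a ⟨ha, e⟩ b h1
      exact ⟨U, hUB.trans Set.sdiff_subset, by omega, h2⟩
    · have h1 : ReachIn G B a v :=
        (hau.mono Set.sdiff_subset).trans (ReachIn.single huv hu.1 hv)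
      exact fin h1 (hab.symm.trans h1)

/-- A bound on the number of vertices needed to join two vertices at treedepth at most `n`. -/
def reachBound : ℕ → ℕ
  | 0 => 0
  | n + 1 => 2 * reachBound n + 2

theorem shortReach_of_tdLE : ∀ (n : ℕ) (A : Set V), tdLE G n A → ShortReach G (reachBound n) A
  | 0, A, h => by
    intro B hB a ha
    rw [show A = ∅ from h] at hB
    exact absurd (hB ha) (Set.notMem_empty a)
  | n + 1, A, h => by
    intro B hB a ha b hab
    obtain ⟨v, hv, hC⟩ := h {w | w ∈ A ∧ ReachIn G A a w} ⟨a, hB ha, rfl⟩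
    have h1 := (shortReach_of_tdLE n _ hC).insert v
    rw [Set.insert_sdiff_singleton, Set.insert_eq_of_mem hv] at h1
    obtain ⟨U, hU, h2⟩ := h1 {x | x ∈ B ∧ ReachIn G B a x}
      (fun x hx => ⟨hB hx.1, hx.2.mono hB⟩) a ⟨ha, ReachIn.refl _⟩ b (hab.restrict)
    exact ⟨U, fun x hx => (hU hx).1, h2⟩

theorem tdLE_of_ncard_le [Finite V] : ∀ (n : ℕ) (A : Set V), A.ncard ≤ n → tdLE G n A
  | 0, A, h => (Set.ncard_eq_zero (Set.toFinite A)).1 (Nat.le_zero.1 h)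
  | n + 1, A, h => by
    rintro C ⟨v, hv, rfl⟩
    have hv' : v ∈ {w | w ∈ A ∧ ReachIn G A v w} := ⟨hv, ReachIn.refl _⟩
    refine ⟨v, hv', tdLE_of_ncard_le n _ ?_⟩
    have h1 := Set.ncard_sdiff_singleton_lt_of_mem hv' (Set.toFinite _)
    have h2 : {w | w ∈ A ∧ ReachIn G A v w}.ncard ≤ A.ncard :=
      Set.ncard_le_ncard (fun x hx => hx.1) (Set.toFinite A)
    omega

theorem tdLE_treedepth [Finite V] (G : SimpleGraph V) : tdLE G (treedepth G) Set.univ :=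
  Nat.sInf_mem (s := {n | tdLE G n Set.univ}) ⟨_, tdLE_of_ncard_le _ _ le_rfl⟩

end Reach

section Minor

variable {V L : Type} {G : SimpleGraph V} {lab : V → Set L} {q : LabGraph L} {S T : Set V}

/-- `G[S]` has `q` as a labeled minor. -/
def HasLabMinor (G : SimpleGraph V) (lab : V → Set L) (q : LabGraph L) (S : Set V) : Prop :=
  ∃ φ, IsLabMinorModelOn q G lab S φ

theorem IsLabMinorModelOn.of_sub {φ : Fin q.n → Set V} (h : IsLabMinorModelOn q G lab S φ)
    (hT : ∀ w, φ w ⊆ T) : IsLabMinorModelOn q G lab T φ :=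
  ⟨hT, h.nonempty, h.conn, h.disj, h.edge, h.labels⟩

theorem HasLabMinor.mono (hST : S ⊆ T) (h : HasLabMinor G lab q S) : HasLabMinor G lab q T :=
  let ⟨φ, hφ⟩ := h
  ⟨φ, hφ.of_sub fun w => (hφ.sub w).trans hST⟩

/-- A graph without labels, viewed as a labeled graph. -/
def FinGraph.unlabeled (H : FinGraph) (L : Type) : LabGraph L := ⟨H.n, H.adj, fun _ => ∅⟩

theorem hasMinorOn_iff (H : FinGraph) (lab : V → Set L) :
    HasMinorOn G S H ↔ HasLabMinor G lab (H.unlabeled L) S :=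
  ⟨fun ⟨φ, h⟩ => ⟨φ, h.sub, h.nonempty, h.conn, h.disj, h.edge, fun _ _ hx => hx.elim⟩,
    fun ⟨φ, h⟩ => ⟨φ, h.sub, h.nonempty, h.conn, h.disj, h.edge⟩⟩

/-- A label-preserving injective homomorphism carries labeled minors along. -/
theorem HasLabMinor.map {U : Set V} {Z : Set L} {f : V → V} (h : HasLabMinor G lab q U)
    (hZ : ∀ w, q.lab w ⊆ Z) (hfS : ∀ u ∈ U, f u ∈ S) (hinj : Set.InjOn f U)
    (hadj : ∀ u ∈ U, ∀ w ∈ U, G.Adj u w → G.Adj (f u) (f w))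
    (hlab : ∀ u ∈ U, ∀ z ∈ Z, z ∈ lab u → z ∈ lab (f u)) : HasLabMinor G lab q S := by
  obtain ⟨φ, h⟩ := h
  refine ⟨fun w => f '' φ w, ?_, fun w => (h.nonempty w).image f, ?_, ?_, ?_, ?_⟩
  · rintro w _ ⟨u, hu, rfl⟩
    exact hfS u (h.sub w hu)
  · rintro w _ ⟨a, ha, rfl⟩ _ ⟨b, hb, rfl⟩
    exact (h.conn w a ha b hb).map (h.sub w) hadj
  · intro w w' hw
    rw [Set.disjoint_left]
    rintro _ ⟨a, ha, rfl⟩ ⟨b, hb, hab⟩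
    have := hinj (h.sub _ hb) (h.sub _ ha) hab
    subst this
    exact Set.disjoint_left.1 (h.disj w w' hw) ha hb
  · intro w w' hw
    obtain ⟨a, ha, b, hb, hab⟩ := h.edge w w' hw
    exact ⟨f a, ⟨a, ha, rfl⟩, f b, ⟨b, hb, rfl⟩, hadj a (h.sub _ ha) b (h.sub _ hb) hab⟩
  · intro w x hx
    obtain ⟨a, ha, hxa⟩ := h.labels w x hx
    exact ⟨f a, ⟨a, ha, rfl⟩, hlab a (h.sub _ ha) x (hZ w hx) hxa⟩

theorem IsLabMinorModelOn.reachIn_iUnion {φ : Fin q.n → Set V}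
    (h : IsLabMinorModelOn q G lab S φ) (hq : q.adj.Connected) {w w' : Fin q.n} {a b : V}
    (ha : a ∈ φ w) (hb : b ∈ φ w') : ReachIn G (⋃ w, φ w) a b := by
  have hr := (SimpleGraph.reachable_iff_reflTransGen w w').1 (hq.preconnected w w')
  induction hr generalizing b with
  | refl => exact (h.conn w a ha b hb).mono (Set.subset_iUnion φ w)
  | @tail x y _ hxy ih =>
    obtain ⟨c, hc, d, hd, hcd⟩ := h.edge x y hxy
    refine ((ih hc).trans (ReachIn.single hcd (Set.mem_iUnion_of_mem _ hc)
      (Set.mem_iUnion_of_mem _ hd))).trans ?_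
    exact (h.conn y d hd b hb).mono (Set.subset_iUnion φ y)

/-- A connected labeled minor of a disjoint union without edges between the parts lives in one
of the parts. -/
theorem HasLabMinor.exists_part {ι : Type*} {A : ι → Set V} (h : HasLabMinor G lab q S)
    (hq : q.adj.Connected) (hS : S ⊆ ⋃ i, A i)
    (hA : ∀ i j, ∀ a ∈ A i, ∀ b ∈ A j, G.Adj a b → i = j) :
    ∃ i, HasLabMinor G lab q (S ∩ A i) := by
  obtain ⟨φ, h⟩ := h
  obtain ⟨w₀⟩ := hq.nonempty
  obtain ⟨a, ha⟩ := h.nonempty w₀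
  obtain ⟨i, hi⟩ := Set.mem_iUnion.1 (hS (h.sub _ ha))
  have hU : (⋃ w, φ w) ⊆ S := Set.iUnion_subset h.sub
  have key : ∀ b, ReachIn G (⋃ w, φ w) a b → b ∈ A i := by
    intro b hb
    induction hb with
    | refl => exact hi
    | @tail x y _ hxy ih =>
      obtain ⟨j, hj⟩ := Set.mem_iUnion.1 (hS (hU hxy.2.2))
      rw [hA i j x ih y hj hxy.1]
      exact hj
  exact ⟨i, φ, h.of_sub fun w b hb => ⟨h.sub w hb, key b (h.reachIn_iUnion hq ha hb)⟩⟩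

theorem not_hasLabMinor_empty (hq : q.adj.Connected) : ¬ HasLabMinor G lab q ∅ := by
  rintro ⟨φ, h⟩
  obtain ⟨w₀⟩ := hq.nonempty
  obtain ⟨a, ha⟩ := h.nonempty w₀
  exact h.sub _ ha

/-- The one-vertex graph with labelset `W`. -/
def LabGraph.single (W : Set L) : LabGraph L := ⟨1, ⊥, fun _ => W⟩

theorem hasLabMinor_single {W : Set L} {a : V} (ha : a ∈ S)
    (h : ∀ x ∈ W, ∃ u, x ∈ lab u ∧ ReachIn G S a u) : HasLabMinor G lab (.single W) S := by
  refine ⟨fun _ => {u | u ∈ S ∧ ReachIn G S a u}, fun _ u hu => hu.1,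
    fun _ => ⟨a, ha, ReachIn.refl _⟩, ?_, ?_, ?_, ?_⟩
  · exact fun _ u hu u' hu' => hu.2.restrict.symm.trans hu'.2.restrict
  · exact fun w w' hw => absurd (Subsingleton.elim (α := Fin 1) w w') hw
  · exact fun w w' hw => hw.elim
  · intro _ x hx
    obtain ⟨u, hu, hau⟩ := h x hx
    exact ⟨u, ⟨hau.mem ha, hau⟩, hu⟩

theorem HasLabMinor.reachIn_of_single {W : Set L} (h : HasLabMinor G lab (.single W) S) {x y : L}
    (hx : x ∈ W) (hy : y ∈ W) :
    ∃ a ∈ S, ∃ b ∈ S, x ∈ lab a ∧ y ∈ lab b ∧ ReachIn G S a b := by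
  obtain ⟨φ, h⟩ := h
  obtain ⟨a, ha, hxa⟩ := h.labels (0 : Fin 1) x hx
  obtain ⟨b, hb, hyb⟩ := h.labels (0 : Fin 1) y hy
  exact ⟨a, h.sub _ ha, b, h.sub _ hb, hxa, hyb, (h.conn _ a ha b hb).mono (h.sub _)⟩

/-- A labeled minor is already present on a small vertex set. -/
theorem HasLabMinor.exists_small {c : ℕ} {Z : Finset L} (h : HasLabMinor G lab q S)
    (hS : ShortReach G c S) (hZ : ∀ w, q.lab w ⊆ Z) :
    ∃ U : Finset V, ↑U ⊆ S ∧ U.card ≤ q.n * ((1 + 2 * q.n + Z.card) * c) ∧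
      HasLabMinor G lab q ↑U := by
  obtain ⟨φ, h⟩ := h
  choose r hr using h.nonempty
  have e1 : ∀ w w', ∃ a ∈ φ w, ∃ b ∈ φ w', q.adj.Adj w w' → G.Adj a b := by
    intro w w'
    by_cases hw : q.adj.Adj w w'
    · obtain ⟨a, ha, b, hb, hab⟩ := h.edge w w' hw
      exact ⟨a, ha, b, hb, fun _ => hab⟩
    · exact ⟨r w, hr w, r w', hr w', fun h => absurd h hw⟩
  have e2 : ∀ w, ∀ x : L, ∃ a ∈ φ w, x ∈ q.lab w → x ∈ lab a := by
    intro w x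
    by_cases hx : x ∈ q.lab w
    · obtain ⟨a, ha, hxa⟩ := h.labels w x hx
      exact ⟨a, ha, fun _ => hxa⟩
    · exact ⟨r w, hr w, fun h => absurd h hx⟩
  choose p hp p' hp' hadj using e1
  choose l hl hlab using e2
  have e3 : ∀ w, ∀ b, ∃ U : Finset V, b ∈ φ w → ↑U ⊆ φ w ∧ U.card ≤ c ∧ r w ∈ U ∧ b ∈ U ∧
      ∀ x ∈ U, ReachIn G ↑U (r w) x := by
    intro w b
    by_cases hb : b ∈ φ w
    · obtain ⟨U, hU⟩ := hS (φ w) (h.sub w) (r w) (hr w) b (h.conn w _ (hr w) b hb)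
      exact ⟨U, fun _ => hU⟩
    · exact ⟨∅, fun h => absurd h hb⟩
  choose K hK using e3
  let R : Fin q.n → Finset V := fun w =>
    ({r w} ∪ Finset.univ.image (p w)) ∪ (Finset.univ.image fun w' => p' w' w) ∪ Z.image (l w)
  have hRφ : ∀ w, ∀ b ∈ R w, b ∈ φ w := by
    intro w b hb
    simp only [R, Finset.mem_union, Finset.mem_singleton, Finset.mem_image, Finset.mem_univ,
      true_and] at hb
    rcases hb with ((rfl | ⟨w', rfl⟩) | ⟨w', rfl⟩) | ⟨x, _, rfl⟩
    · exact hr w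
    · exact hp w w'
    · exact hp' w' w
    · exact hl w x
  have hrR : ∀ w, r w ∈ R w := fun w => by simp [R]
  have hRc : ∀ w, (R w).card ≤ 1 + 2 * q.n + Z.card := by
    intro w
    have h1 := Finset.card_union_le
      (({r w} ∪ Finset.univ.image (p w)) ∪ (Finset.univ.image fun w' => p' w' w)) (Z.image (l w))
    have h2 := Finset.card_union_le
      ({r w} ∪ Finset.univ.image (p w)) (Finset.univ.image fun w' => p' w' w)
    have h3 := Finset.card_union_le {r w} (Finset.univ.image (p w))
    have h4 : (Finset.univ.image (p w)).card ≤ q.n := by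
      simpa using Finset.card_image_le (s := Finset.univ) (f := p w)
    have h5 : (Finset.univ.image fun w' => p' w' w).card ≤ q.n := by
      simpa using Finset.card_image_le (s := Finset.univ) (f := fun w' => p' w' w)
    have h6 : (Z.image (l w)).card ≤ Z.card := Finset.card_image_le
    simp only [Finset.card_singleton] at h3
    simp only [R]
    omega
  let U : Fin q.n → Finset V := fun w => (R w).biUnion (K w)
  have hUφ : ∀ w, (U w : Set V) ⊆ φ w := by
    intro w x hx
    obtain ⟨b, hb, hx⟩ := Finset.mem_biUnion.1 (Finset.mem_coe.1 hx)
    exact (hK w b (hRφ w b hb)).1 hx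
  have hRU : ∀ w, ∀ b ∈ R w, b ∈ U w := fun w b hb =>
    Finset.mem_biUnion.2 ⟨b, hb, (hK w b (hRφ w b hb)).2.2.2.1⟩
  have hconn : ∀ w, ∀ x ∈ U w, ReachIn G (U w) (r w) x := by
    intro w x hx
    obtain ⟨b, hb, hx⟩ := Finset.mem_biUnion.1 hx
    refine ((hK w b (hRφ w b hb)).2.2.2.2 x hx).mono ?_
    exact Finset.coe_subset.2 (Finset.subset_biUnion_of_mem (K w) hb)
  refine ⟨Finset.univ.biUnion U, ?_, ?_, fun w => U w, ?_, ?_, ?_, ?_, ?_, ?_⟩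
  · intro x hx
    obtain ⟨w, _, hx⟩ := Finset.mem_biUnion.1 (Finset.mem_coe.1 hx)
    exact h.sub w (hUφ w hx)
  · refine (Finset.card_biUnion_le_card_mul Finset.univ U ((1 + 2 * q.n + Z.card) * c)
      fun w _ => ?_).trans (by simp)
    refine (Finset.card_biUnion_le_card_mul (R w) (K w) c fun b hb => ?_).trans
      (Nat.mul_le_mul_right c (hRc w))
    exact (hK w b (hRφ w b hb)).2.1
  · exact fun w => Finset.coe_subset.2 (Finset.subset_biUnion_of_mem U (Finset.mem_univ w))
  · exact fun w => ⟨r w, hRU w _ (hrR w)⟩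
  · exact fun w a ha b hb => (hconn w a ha).symm.trans (hconn w b hb)
  · exact fun w w' hw => (h.disj w w' hw).mono (hUφ w) (hUφ w')
  · refine fun w w' hw => ⟨p w w', hRU w _ ?_, p' w w', hRU w' _ ?_, hadj w w' hw⟩ <;> simp [R]
  · refine fun w x hx => ⟨l w x, hRU w _ ?_, hlab w x hx⟩
    simp only [R, Finset.mem_union, Finset.mem_image]
    exact Or.inr ⟨x, hZ w hx, rfl⟩

end Minor

section Embedding

variable {V L : Type} {G : SimpleGraph V} {lab : V → Set L}

/-- Every set of at most `M` vertices of `G[S]` is mapped into `S'` by an injective homomorphism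
preserving the labels from `Z`. -/
def LocalEmb (G : SimpleGraph V) (lab : V → Set L) (M : ℕ) (Z : Set L) (S S' : Set V) : Prop :=
  ∀ U : Finset V, ↑U ⊆ S → U.card ≤ M → ∃ f : V → V, (∀ u ∈ U, f u ∈ S') ∧
    Set.InjOn f ↑U ∧ (∀ u ∈ U, ∀ w ∈ U, G.Adj u w → G.Adj (f u) (f w)) ∧
    ∀ u ∈ U, ∀ z ∈ Z, z ∈ lab u → z ∈ lab (f u)

theorem LocalEmb.mono {M M' : ℕ} {Z Z' : Set L} {S S' : Set V} (h : LocalEmb G lab M' Z' S S')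
    (hM : M ≤ M') (hZ : Z ⊆ Z') : LocalEmb G lab M Z S S' := by
  intro U hU hUM
  obtain ⟨f, h1, h2, h3, h4⟩ := h U hU (hUM.trans hM)
  exact ⟨f, h1, h2, h3, fun u hu z hz => h4 u hu z (hZ hz)⟩

/-- A local embedding preserving adjacency to `v` extends to `v`. -/
theorem LocalEmb.insert {M : ℕ} {Z : Set L} {B B' : Set V} {nb : V → L} {v : V}
    (hnb : ∀ u, nb v ∈ lab u ↔ G.Adj u v) (h : LocalEmb G lab M Z B B') (hv : nb v ∈ Z)
    (hvB' : v ∉ B') : LocalEmb G lab M Z (insert v B) (insert v B') := by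
  intro U hU hUM
  obtain ⟨f, h1, h2, h3, h4⟩ := h (U.erase v)
    (fun x hx => (hU (Finset.mem_of_mem_erase hx)).resolve_left (Finset.ne_of_mem_erase hx))
    (Finset.card_erase_le.trans hUM)
  have hne : ∀ {u}, u ∈ U → u ≠ v → u ∈ U.erase v := fun hu hv => Finset.mem_erase.2 ⟨hv, hu⟩
  have hfv : ∀ {u}, u ∈ U → u ≠ v → f u ≠ v := fun hu hv e => hvB' (e ▸ h1 _ (hne hu hv))
  have hadj : ∀ {u}, u ∈ U → u ≠ v → G.Adj u v → G.Adj (f u) v := fun hu hv huv =>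
    (hnb _).1 (h4 _ (hne hu hv) _ ‹_› ((hnb _).2 huv))
  refine ⟨fun u => if u = v then v else f u, ?_, ?_, ?_, ?_⟩
  · intro u hu
    by_cases e : u = v
    · simp [e]
    · simp only [e, if_false]
      exact Or.inr (h1 u (hne hu e))
  · intro a ha b hb hab
    by_cases ea : a = v <;> by_cases eb : b = v <;> simp only [ea, eb, if_true, if_false] at hab
    · rw [ea, eb]
    · exact absurd hab.symm (hfv hb eb)
    · exact absurd hab (hfv ha ea)
    · exact h2 (hne ha ea) (hne hb eb) hab
  · intro a ha b hb hab
    by_cases ea : a = v <;> by_cases eb : b = v <;> simp only [ea, eb, if_true, if_false]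
    · rw [ea, eb] at hab
      exact hab
    · rw [ea] at hab
      exact (hadj hb eb hab.symm).symm
    · rw [eb] at hab
      exact hadj ha ea hab
    · exact h3 a (hne ha ea) b (hne hb eb) hab
  · intro u hu z hz hzu
    by_cases e : u = v
    · simpa [e] using hzu
    · simpa only [e, if_false] using h4 u (hne hu e) z hz hzu

theorem HasLabMinor.of_localEmb {q : LabGraph L} {M : ℕ} {Z : Set L} {S S' : Set V} {U : Finset V}
    (h : HasLabMinor G lab q ↑U) (hS : LocalEmb G lab M Z S S') (hU : ↑U ⊆ S) (hUM : U.card ≤ M)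
    (hZ : ∀ w, q.lab w ⊆ Z) : HasLabMinor G lab q S' := by
  obtain ⟨f, h1, h2, h3, h4⟩ := hS U hU hUM
  exact h.map hZ h1 h2 h3 h4

/-- Graphs on a subset of `Fin M` with vertex labels from `α`. -/
abbrev Pattern (M : ℕ) (α : Type) : Type :=
  Set (Fin M) × (Fin M → Set (Fin M)) × (Fin M → Set α)

/-- The set of patterns on at most `M` vertices occurring in `G[S]`, labeled from `Z`. -/
def patterns (G : SimpleGraph V) (lab : V → Set L) (M : ℕ) (Z : Finset L) (S : Set V) :
    Set (Pattern M Z) :=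
  {P | ∃ f : Fin M → V, (∀ a ∈ P.1, f a ∈ S) ∧ Set.InjOn f P.1 ∧
    (∀ a ∈ P.1, ∀ b ∈ P.1, b ∈ P.2.1 a → G.Adj (f a) (f b)) ∧
    ∀ a ∈ P.1, ∀ z ∈ P.2.2 a, (z : L) ∈ lab (f a)}

theorem patterns_subset_iff {M : ℕ} {Z : Finset L} {S S' : Set V} :
    patterns G lab M Z S ⊆ patterns G lab M Z S' ↔ LocalEmb G lab M Z S S' := by
  constructor
  · intro h U hU hUM
    rcases U.eq_empty_or_nonempty with rfl | ⟨u₀, hu₀⟩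
    · exact ⟨id, by simp⟩
    obtain ⟨e⟩ : Nonempty (U ↪ Fin M) :=
      Function.Embedding.nonempty_of_card_le (by simpa using hUM)
    let g : Fin M → V := fun a => if h : ∃ u : U, e u = a then (h.choose : V) else u₀
    have hg : ∀ u : U, g (e u) = u := by
      intro u
      have h' : ∃ u' : U, e u' = e u := ⟨u, rfl⟩
      simp only [g, h', dif_pos]
      exact congrArg Subtype.val (e.injective h'.choose_spec)
    have hP : ((Set.range e, fun a => {b | G.Adj (g a) (g b)}, fun a => {z | (z : L) ∈ lab (g a)}) :
        Pattern M Z) ∈ patterns G lab M Z S := by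
      refine ⟨g, ?_, ?_, fun a _ b _ h => h, fun a _ z h => h⟩
      · rintro _ ⟨u, rfl⟩
        rw [hg]
        exact hU u.2
      · rintro _ ⟨u, rfl⟩ _ ⟨u', rfl⟩ huu
        rw [hg, hg] at huu
        rw [Subtype.ext huu]
    obtain ⟨f, h1, h2, h3, h4⟩ := h hP
    let k : V → V := fun u => if h : u ∈ U then f (e ⟨u, h⟩) else u
    have hk : ∀ u, ∀ h : u ∈ U, k u = f (e ⟨u, h⟩) := fun u h => by simp [k, h]
    refine ⟨k, ?_, ?_, ?_, ?_⟩
    · intro u hu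
      rw [hk u hu]
      exact h1 _ ⟨_, rfl⟩
    · intro u hu w hw huw
      rw [hk u hu, hk w hw] at huw
      exact congrArg Subtype.val (e.injective (h2 ⟨_, rfl⟩ ⟨_, rfl⟩ huw))
    · intro u hu w hw huw
      rw [hk u hu, hk w hw]
      refine h3 _ ⟨_, rfl⟩ _ ⟨_, rfl⟩ ?_
      simpa [hg] using huw
    · intro u hu z hz hzu
      rw [hk u hu]
      refine h4 _ ⟨_, rfl⟩ ⟨z, hz⟩ ?_
      simpa [hg] using hzu
  · rintro h P ⟨f, h1, h2, h3, h4⟩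
    let U : Finset V := Finset.univ.image fun a : P.1 => f a
    have hfU : ∀ a ∈ P.1, f a ∈ U := fun a ha =>
      Finset.mem_image.2 ⟨⟨a, ha⟩, Finset.mem_univ _, rfl⟩
    have hUc : U.card ≤ M := by
      refine Finset.card_image_le.trans ?_
      simpa using Fintype.card_subtype_le (fun a => a ∈ P.1)
    have hUS : (U : Set V) ⊆ S := by
      intro x hx
      obtain ⟨a, _, rfl⟩ := Finset.mem_image.1 (Finset.mem_coe.1 hx)
      exact h1 a a.2
    obtain ⟨k, k1, k2, k3, k4⟩ := h U hUS hUc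
    refine ⟨k ∘ f, fun a ha => k1 _ (hfU a ha), ?_, ?_, ?_⟩
    · intro a ha b hb hab
      exact h2 ha hb (k2 (hfU a ha) (hfU b hb) hab)
    · exact fun a ha b hb hab => k3 _ (hfU a ha) _ (hfU b hb) (h3 a ha b hb hab)
    · exact fun a ha z hz => k4 _ (hfU a ha) z z.2 (h4 a ha z hz)

/-- The number of sets of patterns on `M` vertices with `ζ` labels. -/
def patternBound (M ζ : ℕ) : ℕ := 2 ^ (2 ^ M * ((2 ^ M) ^ M * (2 ^ ζ) ^ M))

theorem card_set_pattern_le {M ζ : ℕ} {Z : Finset L} (hZ : Z.card ≤ ζ) :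
    Fintype.card (Set (Pattern M Z)) ≤ patternBound M ζ := by
  have : Fintype.card (Set (Pattern M Z)) = patternBound M Z.card := by
    simp [patternBound, Fintype.card_prod]
  rw [this]
  unfold patternBound
  gcongr <;> norm_num

end Embedding

section LabGraphBound

/-- The number of labeled graphs on at most `N` vertices with labels from a set of size `ζ`. -/
def labGraphBound (N ζ : ℕ) : ℕ :=
  Nat.card (Σ m : Fin (N + 1), SimpleGraph (Fin m) × (Fin m → Set (Fin ζ)))

theorem exists_finset_labGraph {L : Type} {N ζ : ℕ} {Z : Finset L} (hZ : Z.card ≤ ζ)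
    (Q : Set (LabGraph L)) (hN : ∀ q ∈ Q, q.n ≤ N) (hl : ∀ q ∈ Q, ∀ w, q.lab w ⊆ Z) :
    ∃ s : Finset (LabGraph L), ↑s = Q ∧ s.card ≤ labGraphBound N ζ := by
  obtain ⟨e⟩ : Nonempty (Z ↪ Fin ζ) :=
    Function.Embedding.nonempty_of_card_le (by simpa using hZ)
  let f : Q → Σ m : Fin (N + 1), SimpleGraph (Fin m) × (Fin m → Set (Fin ζ)) := fun q =>
    ⟨⟨q.1.n, Nat.lt_succ_of_le (hN q q.2)⟩, q.1.adj, fun w => e '' {z | (z : L) ∈ q.1.lab w}⟩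
  have hf : Function.Injective f := by
    rintro ⟨⟨n, adj, lab⟩, hq⟩ ⟨⟨n', adj', lab'⟩, hq'⟩ h
    simp only [f, Sigma.mk.injEq, Fin.mk.injEq] at h
    obtain ⟨rfl, h⟩ := h
    simp only [heq_eq_eq, Prod.mk.injEq] at h
    obtain ⟨rfl, h⟩ := h
    have : lab = lab' := by
      funext w
      have h1 := e.injective.image_injective (congrFun h w)
      ext z
      constructor
      · intro hz
        exact (Set.ext_iff.1 h1 ⟨z, hl _ hq w hz⟩).1 hz
      · intro hz
        exact (Set.ext_iff.1 h1 ⟨z, hl _ hq' w hz⟩).2 hz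
    subst this
    rfl
  have : Finite Q := Finite.of_injective f hf
  refine ⟨(Set.toFinite Q).toFinset, by simp, ?_⟩
  rw [← Set.ncard_eq_toFinset_card Q (Set.toFinite Q)]
  exact Nat.card_le_card_of_injective f hf

end LabGraphBound

section Deletion

variable {V : Type} {F : Set FinGraph} {G : SimpleGraph V} {A D Y : Set V} {v : V}

theorem optF_le (h : FDelSetOn F G A Y) : optF F G A ≤ Y.ncard :=
  Nat.sInf_le ⟨Y, h, rfl⟩

theorem exists_fDelSetOn_ncard_eq (hF : ∀ H ∈ F, H.adj.Connected) :
    ∃ Y, FDelSetOn F G A Y ∧ Y.ncard = optF F G A := by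
  have h : FDelSetOn F G A A := by
    refine ⟨subset_rfl, fun H hH h => ?_⟩
    rw [Set.sdiff_self, hasMinorOn_iff H (fun _ => (∅ : Set Empty))] at h
    exact not_hasLabMinor_empty (hF H hH) h
  exact Nat.sInf_mem (s := Set.ncard '' {Y | FDelSetOn F G A Y}) ⟨_, A, h, rfl⟩

theorem HasMinorOn.mono {H : FinGraph} {S T : Set V} (hST : S ⊆ T) (h : HasMinorOn G S H) :
    HasMinorOn G T H := by
  rw [hasMinorOn_iff H (fun _ => (∅ : Set Empty))] at h ⊢
  exact HasLabMinor.mono hST h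

theorem FDelSetOn.inter (h : FDelSetOn F G A Y) (hDA : D ⊆ A) : FDelSetOn F G D (Y ∩ D) := by
  refine ⟨Set.inter_subset_right, fun H hH hm => h.2 H hH (hm.mono ?_)⟩
  rintro x ⟨hx, hxY⟩
  exact ⟨hDA hx, fun h' => hxY ⟨h', hx⟩⟩

theorem FDelSetOn.insert (h : FDelSetOn F G D Y) :
    FDelSetOn F G (insert v D) (insert v Y) := by
  refine ⟨Set.insert_subset_insert h.1, fun H hH hm => h.2 H hH (hm.mono ?_)⟩
  rintro x ⟨hx, hxY⟩
  simp only [Set.mem_insert_iff, not_or] at hx hxY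
  exact ⟨hx.resolve_left hxY.1, hxY.2⟩

theorem optF_insert_le [Finite V] (hF : ∀ H ∈ F, H.adj.Connected) :
    optF F G (insert v D) ≤ optF F G D + 1 := by
  obtain ⟨Y, hY, hc⟩ := exists_fDelSetOn_ncard_eq (G := G) (A := D) hF
  exact (optF_le hY.insert).trans ((Set.ncard_insert_le v Y).trans (by omega))

end Deletion

section Root

variable {V L : Type} {F : Set FinGraph} {G : SimpleGraph V} {lab : V → Set L}

/-- Among the `F`-deletion sets `Y` of `G[A]` with at most `optF F G A + e` vertices for which
`A \ Y` has a property determined by its `Z`-labeled subgraphs on at most `M` vertices: if all of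
them leave a minor from a `θ`-saturated family, then all of them leave a minor from a subfamily
of size at most `B`. -/
def SmallObstruction (F : Set FinGraph) (G : SimpleGraph V) (lab : V → Set L) (A : Set V)
    (M e θ N ζ B : ℕ) : Prop :=
  ∀ (Z : Finset L) (X : Set L) (Q : Set (LabGraph L)) (P : Set V → Prop) (b : ℕ),
    Z.card ≤ ζ → (∀ q ∈ Q, q.adj.Connected) → (∀ q ∈ Q, q.n ≤ N) →
    (∀ q ∈ Q, ∀ w, q.lab w ⊆ ↑Z ∪ X) →
    (∀ W : Finset L, ↑W ⊆ X → W.card = θ → LabGraph.single ↑W ∈ Q) →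
    (∀ S ⊆ A, ∀ S' ⊆ A, LocalEmb G lab M Z S S' → P S' → P S) →
    b ≤ optF F G A + e →
    (∀ Y, FDelSetOn F G A Y → Y.ncard ≤ b → P (A \ Y) → ∃ q ∈ Q, HasLabMinor G lab q (A \ Y)) →
    ∃ Qs : Finset (LabGraph L), ↑Qs ⊆ Q ∧ Qs.card ≤ B ∧
      ∀ Y, FDelSetOn F G A Y → Y.ncard ≤ b → P (A \ Y) → ∃ q ∈ Qs, HasLabMinor G lab q (A \ Y)

/-- Bound on the subfamily needed for the deletion sets avoiding the root, when `k` more labels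
have to be reached from the root. -/
def branchBound (B N : ℕ) : ℕ → ℕ
  | 0 => 1
  | k + 1 => branchBound B N k + (B + N + B * branchBound B N k)

/-- Bound on the number of vertices needed to certify a labeled minor. -/
def certBound (M N ζ c : ℕ) : ℕ := M + N * ((1 + 2 * N + ζ) * (2 * c + 2))

theorem certBound_ge {M N ζ c n z : ℕ} (hn : n ≤ N) (hz : z ≤ ζ) :
    n * ((1 + 2 * n + z) * (2 * c + 2)) ≤ certBound M N ζ c := by
  unfold certBound
  refine le_trans ?_ (Nat.le_add_left _ M)
  gcongr

theorem SmallObstruction.insert_root [Finite V] (hF : ∀ H ∈ F, H.adj.Connected) {K : ℕ}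
    (hK : ∀ H ∈ F, H.n ≤ K) {nb : V → L} (hnb : ∀ u w, nb w ∈ lab u ↔ G.Adj u w)
    {D : Set V} {v : V} (hvD : v ∉ D) {c M e θ N ζ B₀ B₁ : ℕ} (hc : ShortReach G c D)
    (h₀ : SmallObstruction F G lab D M e θ N ζ B₀)
    (h₁ : SmallObstruction F G lab D (certBound M (N + K) (ζ + θ) c) (e + 1) θ (N + 1)
      (ζ + θ + 1) B₁) :
    SmallObstruction F G lab (insert v D) M e θ N ζ
      (B₀ + branchBound B₁ (labGraphBound N (ζ + θ)) θ) := by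
  intro Z X Q P b hZ hQc hQN hQl hQs hP hb hQ
  set A : Set V := insert v D with hA
  have hDA : D ⊆ A := Set.subset_insert v D
  have hcA : ShortReach G (2 * c + 2) A := hc.insert v
  obtain ⟨Q₀, hQ₀, hQ₀c, hQ₀m⟩ : ∃ Q₀ : Finset (LabGraph L), ↑Q₀ ⊆ Q ∧ Q₀.card ≤ B₀ ∧
      ∀ Y, FDelSetOn F G A Y → Y.ncard ≤ b → P (A \ Y) → v ∈ Y →
        ∃ q ∈ Q₀, HasLabMinor G lab q (A \ Y) := by
    rcases Nat.eq_zero_or_pos b with rfl | hb0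
    · refine ⟨∅, by simp, by simp, fun Y _ hY _ hvY => ?_⟩
      rw [(Set.ncard_eq_zero (Set.toFinite Y)).1 (Nat.le_zero.1 hY)] at hvY
      exact hvY.elim
    · have hopt : optF F G A ≤ optF F G D + 1 := optF_insert_le hF
      obtain ⟨Q₀, hQ₀, hQ₀c, hQ₀m⟩ := h₀ Z X Q P (b - 1) hZ hQc hQN hQl hQs
        (fun S hS S' hS' => hP S (hS.trans hDA) S' (hS'.trans hDA)) (by omega) (by
          intro Y hY hYb hPY
          have e1 : A \ insert v Y = D \ Y := by
            ext x
            simp only [hA, Set.mem_sdiff, Set.mem_insert_iff]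
            constructor
            · tauto
            · rintro ⟨h1, h2⟩
              refine ⟨Or.inr h1, ?_⟩
              rintro (rfl | h3)
              exacts [hvD h1, h2 h3]
          have h1 := hQ (insert v Y) hY.insert
            ((Set.ncard_insert_le v Y).trans (by omega))
          rw [e1] at h1
          exact h1 hPY)
      refine ⟨Q₀, hQ₀, hQ₀c, fun Y hY hYb hPY hvY => ?_⟩
      have e1 : A \ Y = D \ (Y ∩ D) := by
        ext x
        simp only [hA, Set.mem_sdiff, Set.mem_insert_iff, Set.mem_inter_iff]
        constructor
        · rintro ⟨rfl | h1, h2⟩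
          · exact absurd hvY h2
          · tauto
        · tauto
      have h1 : (Y ∩ D).ncard < Y.ncard := by
        refine Set.ncard_lt_ncard ⟨Set.inter_subset_left, fun h => hvD (h hvY).2⟩ (Set.toFinite Y)
      rw [e1] at hPY ⊢
      exact hQ₀m _ (hY.inter hDA) (by omega) hPY
  have branch : ∀ k, ∀ W : Finset L, ↑W ⊆ X → W.card + k = θ →
      ∃ Q₁ : Finset (LabGraph L), ↑Q₁ ⊆ Q ∧
        Q₁.card ≤ branchBound B₁ (labGraphBound N (ζ + θ)) k ∧
        ∀ Y, FDelSetOn F G A Y → Y.ncard ≤ b → P (A \ Y) → v ∉ Y →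
          (∀ x ∈ W, ∃ u, x ∈ lab u ∧ ReachIn G (A \ Y) v u) →
          ∃ q ∈ Q₁, HasLabMinor G lab q (A \ Y) := by
    intro k
    induction k with
    | zero =>
      intro W hW hWc
      refine ⟨{LabGraph.single ↑W}, by simpa using hQs W hW hWc, by simp [branchBound], ?_⟩
      intro Y hY _ _ hvY hr
      refine ⟨_, Finset.mem_singleton_self _, hasLabMinor_single ⟨Set.mem_insert v D, hvY⟩ hr⟩
    | succ k ih =>
      intro W hW hWc
      have ihx : ∀ x, ∃ Q₁ : Finset (LabGraph L), ↑Q₁ ⊆ Q ∧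
          Q₁.card ≤ branchBound B₁ (labGraphBound N (ζ + θ)) k ∧ (x ∈ X → x ∉ W →
          ∀ Y, FDelSetOn F G A Y → Y.ncard ≤ b → P (A \ Y) → v ∉ Y →
          (∀ x ∈ W, ∃ u, x ∈ lab u ∧ ReachIn G (A \ Y) v u) →
          (∃ u, x ∈ lab u ∧ ReachIn G (A \ Y) v u) → ∃ q ∈ Q₁, HasLabMinor G lab q (A \ Y)) := by
        intro x
        by_cases hx : x ∈ X ∧ x ∉ W
        · obtain ⟨Q₁, h1, h2, h3⟩ := ih (Insert.insert x W)
            (by rw [Finset.coe_insert]; exact Set.insert_subset hx.1 hW)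
            (by rw [Finset.card_insert_of_notMem hx.2]; omega)
          refine ⟨Q₁, h1, h2, fun _ _ Y hY hYb hPY hvY hr hrx => h3 Y hY hYb hPY hvY ?_⟩
          intro y hy
          rcases Finset.mem_insert.1 hy with rfl | hy
          exacts [hrx, hr y hy]
        · exact ⟨∅, by simp, by simp, fun h1 h2 => absurd ⟨h1, h2⟩ hx⟩
      choose R hRQ hRc hR using ihx
      by_cases hvx : ∃ x, x ∈ lab v ∧ x ∈ X ∧ x ∉ W
      · obtain ⟨x, hxv, hxX, hxW⟩ := hvx
        refine ⟨R x, hRQ x, (hRc x).trans (Nat.le_add_right _ _), fun Y hY hYb hPY hvY hr => ?_⟩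
        exact hR x hxX hxW Y hY hYb hPY hvY hr ⟨v, hxv, ReachIn.refl _⟩
      push Not at hvx
      have hZW : (Z ∪ W).card ≤ ζ + θ := (Finset.card_union_le _ _).trans (by omega)
      obtain ⟨Q₂, hQ₂, hQ₂c⟩ := exists_finset_labGraph hZW
        {q | q ∈ Q ∧ ∀ w, q.lab w ⊆ ↑(Z ∪ W)} (fun q hq => hQN q hq.1) (fun q hq => hq.2)
      have mQ₂ : ∀ {q}, q ∈ Q₂ ↔ q ∈ Q ∧ ∀ w, q.lab w ⊆ ↑(Z ∪ W) := fun {q} => by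
        rw [← Finset.mem_coe, hQ₂]; rfl
      let Q' : Set (LabGraph L) :=
        Q ∪ {q | ∃ x, x ∈ X ∧ x ∉ W ∧ q = LabGraph.single {nb v, x}}
      let P' : Set V → Prop := fun B => P (insert v B) ∧
        (∀ H ∈ F, ¬ HasMinorOn G (insert v B) H) ∧ ∀ q ∈ Q₂, ¬ HasLabMinor G lab q (insert v B)
      obtain ⟨Q₃, hQ₃, hQ₃c, hQ₃m⟩ : ∃ Q₃ : Finset (LabGraph L), ↑Q₃ ⊆ Q' ∧ Q₃.card ≤ B₁ ∧
          ∀ Y, FDelSetOn F G D Y → Y.ncard ≤ b → P' (D \ Y) →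
            ∃ q ∈ Q₃, HasLabMinor G lab q (D \ Y) := by
        refine h₁ (Insert.insert (nb v) (Z ∪ W)) (X \ ↑W) Q' P' b
          ((Finset.card_insert_le _ _).trans (by omega)) ?_ ?_ ?_ ?_ ?_ ?_ ?_
        · rintro q (hq | ⟨x, _, _, rfl⟩)
          · exact hQc q hq
          · refine { preconnected := fun a b => ?_, nonempty := ⟨(0 : Fin 1)⟩ }
            rw [Subsingleton.elim (α := Fin 1) a b]
        · rintro q (hq | ⟨x, _, _, rfl⟩)
          · exact (hQN q hq).trans (Nat.le_succ N)
          · exact Nat.succ_le_succ (Nat.zero_le N)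
        · rintro q (hq | ⟨x, hxX, hxW, rfl⟩) w y hy
          · by_cases hyW : y ∈ W
            · exact Or.inl (by simp [hyW])
            · rcases hQl q hq w hy with h | h
              · exact Or.inl (by simp [Finset.mem_coe.1 h])
              · exact Or.inr ⟨h, hyW⟩
          · rcases hy with rfl | rfl
            · exact Or.inl (by simp)
            · exact Or.inr ⟨hxX, hxW⟩
        · exact fun W' hW' hc' => Or.inl (hQs W' (hW'.trans Set.sdiff_subset) hc')
        · intro S hS S' hS' hSS ⟨p1, p2, p3⟩
          have hemb := hSS.insert (fun u => hnb u v) (by simp) (fun h => hvD (hS' h))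
          have hSA : insert v S ⊆ A := Set.insert_subset_insert hS
          have hSr : ShortReach G (2 * c + 2) (insert v S) := fun B hB => hcA B (hB.trans hSA)
          refine ⟨?_, ?_, ?_⟩
          · refine hP _ hSA _ (Set.insert_subset_insert hS') (hemb.mono ?_ ?_) p1
            · exact Nat.le_add_right _ _
            · intro z hz
              simp [Finset.mem_coe.1 hz]
          · intro H hH hm
            refine p2 H hH ?_
            rw [hasMinorOn_iff H lab] at hm ⊢
            obtain ⟨U, hU, hUc, hm⟩ := hm.exists_small (Z := ∅) hSr (fun w => Set.empty_subset _)
            exact hm.of_localEmb hemb hU (hUc.trans (certBound_ge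
              ((hK H hH).trans (Nat.le_add_left K N)) (by simp))) (fun w => Set.empty_subset _)
          · intro q hq hm
            refine p3 q hq ?_
            obtain ⟨hqQ, hql⟩ := mQ₂.1 hq
            obtain ⟨U, hU, hUc, hm⟩ := hm.exists_small hSr hql
            refine hm.of_localEmb hemb hU (hUc.trans (certBound_ge
              ((hQN q hqQ).trans (Nat.le_add_right N K)) hZW)) (fun w => (hql w).trans ?_)
            simp
        · have hopt : optF F G A ≤ optF F G D + 1 := optF_insert_le hF
          omega
        · rintro Y hY hYb ⟨p1, p2, p3⟩
          have hvY : v ∉ Y := fun h => hvD (hY.1 h)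
          have e1 : insert v (D \ Y) = A \ Y := by
            ext x
            simp only [hA, Set.mem_sdiff, Set.mem_insert_iff]
            constructor
            · rintro (rfl | h)
              exacts [⟨Or.inl rfl, hvY⟩, ⟨Or.inr h.1, h.2⟩]
            · tauto
          rw [e1] at p1 p2
          simp only [e1] at p3
          obtain ⟨q, hq, φ, hφ⟩ := hQ Y ⟨hY.1.trans hDA, p2⟩ hYb p1
          by_cases hv : ∃ w, v ∈ φ w
          · obtain ⟨w₀, hw₀⟩ := hv
            by_contra! hno
            refine p3 q (mQ₂.2 ⟨hq, fun w x hx => ?_⟩) ⟨φ, hφ⟩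
            rcases hQl q hq w hx with h | hxX
            · simp [Finset.mem_coe.1 h]
            by_contra hxZW
            have hxW : x ∉ W := fun h => hxZW (by simp [h])
            obtain ⟨u, hu, hxu⟩ := hφ.labels w x hx
            have huv : ReachIn G (A \ Y) u v := (hφ.reachIn_iUnion (hQc q hq) hu hw₀).mono
              (Set.iUnion_subset hφ.sub)
            have hne : u ≠ v := by
              rintro rfl
              exact hxW (hvx x hxu hxX)
            obtain ⟨_, u', hu', huu', hadj⟩ := huv.exists_adj (hφ.sub w hu) hne
            have e2 : (A \ Y) \ {v} ⊆ D \ Y := fun y hy => ⟨hy.1.1.resolve_left hy.2, hy.1.2⟩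
            refine hno (LabGraph.single {nb v, x}) (Or.inr ⟨x, hxX, hxW, rfl⟩)
              (hasLabMinor_single (a := u) (e2 ⟨hφ.sub w hu, hne⟩) ?_)
            rintro y (rfl | rfl)
            · exact ⟨u', (hnb u' v).2 hadj, huu'.mono e2⟩
            · exact ⟨u, hxu, ReachIn.refl _⟩
          · push Not at hv
            refine ⟨q, Or.inl hq, φ, hφ.of_sub fun w y hy => ?_⟩
            obtain ⟨h1, h2⟩ := hφ.sub w hy
            exact ⟨h1.resolve_left fun e => hv w (e ▸ hy), h2⟩
      let f : LabGraph L → Finset (LabGraph L) := fun q =>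
        if h : ∃ x, x ∈ X ∧ x ∉ W ∧ q = LabGraph.single {nb v, x} then R h.choose else ∅
      have hfc : ∀ q, (f q).card ≤ branchBound B₁ (labGraphBound N (ζ + θ)) k := by
        intro q
        by_cases h : ∃ x, x ∈ X ∧ x ∉ W ∧ q = LabGraph.single {nb v, x}
        · simp only [f, h, dif_pos]
          exact hRc _
        · simp [f, h]
      have hfQ : ∀ q, ↑(f q) ⊆ Q := by
        intro q
        by_cases h : ∃ x, x ∈ X ∧ x ∉ W ∧ q = LabGraph.single {nb v, x}
        · simp only [f, h, dif_pos]
          exact hRQ _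
        · simp [f, h]
      refine ⟨Q₃.filter (· ∈ Q) ∪ Q₂ ∪ Q₃.biUnion f, ?_, ?_, ?_⟩
      · intro q hq
        simp only [Finset.coe_union, Set.mem_union, Finset.mem_coe, Finset.mem_filter,
          Finset.mem_biUnion] at hq
        rcases hq with (hq | hq) | ⟨q', _, hq⟩
        exacts [hq.2, (mQ₂.1 hq).1, hfQ q' hq]
      · have c1 : (Q₃.biUnion f).card ≤ B₁ * branchBound B₁ (labGraphBound N (ζ + θ)) k :=
          (Finset.card_biUnion_le_card_mul _ _ _ fun q _ => hfc q).trans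
            (Nat.mul_le_mul_right _ hQ₃c)
        have c2 : (Q₃.filter (· ∈ Q)).card ≤ B₁ := (Finset.card_filter_le _ _).trans hQ₃c
        have c3 := Finset.card_union_le (Q₃.filter (· ∈ Q) ∪ Q₂) (Q₃.biUnion f)
        have c4 := Finset.card_union_le (Q₃.filter (· ∈ Q)) Q₂
        simp only [branchBound]
        omega
      · intro Y hY hYb hPY hvY hr
        by_contra! hno
        have hYD : Y ⊆ D := fun y hy => (hY.1 hy).resolve_left fun e => hvY (e ▸ hy)
        have e1 : insert v (D \ Y) = A \ Y := by
          ext x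
          simp only [hA, Set.mem_sdiff, Set.mem_insert_iff]
          constructor
          · rintro (rfl | h)
            exacts [⟨Or.inl rfl, hvY⟩, ⟨Or.inr h.1, h.2⟩]
          · tauto
        have hsub : D \ Y ⊆ A \ Y := Set.sdiff_subset_sdiff_left hDA
        obtain ⟨q, hq, hqm⟩ := hQ₃m Y ⟨hYD, fun H hH h => hY.2 H hH (h.mono hsub)⟩ hYb (by
          simp only [P', e1]
          exact ⟨hPY, hY.2, fun q hq => hno q (by simp [hq])⟩)
        rcases hQ₃ hq with hqQ | hx
        · exact hno q (by simp [hq, hqQ]) (hqm.mono hsub)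
        · have hfq : f q = R hx.choose := dif_pos hx
          obtain ⟨hxX, hxW, hxq⟩ := hx.choose_spec
          set x := hx.choose
          rw [hxq] at hqm
          obtain ⟨a, ha, u, hu, hva, hxu, hau⟩ := hqm.reachIn_of_single
            (x := nb v) (y := x) (by simp) (by simp)
          have hvu : ReachIn G (A \ Y) v u :=
            ReachIn.trans (ReachIn.single ((hnb a v).1 hva).symm
              ⟨Set.mem_insert v D, hvY⟩ (hsub ha)) (hau.mono hsub)
          obtain ⟨q', hq', hm⟩ := hR x hxX hxW Y hY hYb hPY hvY hr ⟨u, hxu, hvu⟩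
          refine hno q' ?_ hm
          simp only [Finset.mem_union, Finset.mem_biUnion]
          exact Or.inr ⟨q, hq, hfq ▸ hq'⟩
  obtain ⟨Q₁, hQ₁, hQ₁c, hQ₁m⟩ := branch θ ∅ (by simp) (by simp)
  refine ⟨Q₀ ∪ Q₁, by simp [hQ₀, hQ₁], (Finset.card_union_le _ _).trans (by omega), ?_⟩
  intro Y hY hYb hPY
  by_cases hvY : v ∈ Y
  · obtain ⟨q, hq, hm⟩ := hQ₀m Y hY hYb hPY hvY
    exact ⟨q, by simp [hq], hm⟩
  · obtain ⟨q, hq, hm⟩ := hQ₁m Y hY hYb hPY hvY (by simp)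
    exact ⟨q, by simp [hq], hm⟩

end Root

section Union

variable {V L ι : Type} {F : Set FinGraph} {G : SimpleGraph V} {lab : V → Set L}
  {A : ι → Set V}

theorem FDelSetOn.iUnion (hF : ∀ H ∈ F, H.adj.Connected)
    (hA : ∀ i j, ∀ a ∈ A i, ∀ b ∈ A j, G.Adj a b → i = j) {Y : ι → Set V}
    (hY : ∀ i, FDelSetOn F G (A i) (Y i)) : FDelSetOn F G (⋃ i, A i) (⋃ i, Y i) := by
  refine ⟨Set.iUnion_mono fun i => (hY i).1, fun H hH hm => ?_⟩
  rw [hasMinorOn_iff H (fun _ => (∅ : Set Empty))] at hm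
  obtain ⟨i, hi⟩ := hm.exists_part (hF H hH) Set.sdiff_subset hA
  refine (hY i).2 H hH ?_
  rw [hasMinorOn_iff H (fun _ => (∅ : Set Empty))]
  exact hi.mono fun x hx => ⟨hx.2, fun h => hx.1.2 (Set.mem_iUnion_of_mem i h)⟩

theorem ncard_iUnion_le_sum [Finite V] [Fintype ι] (Y : ι → Set V) :
    (⋃ i, Y i).ncard ≤ ∑ i, (Y i).ncard := by
  have := Fintype.ofFinite V
  have h : (⋃ i, Y i) = ↑(Finset.univ.biUnion fun i => (Y i).toFinset) := by
    ext x
    simp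
  rw [h, Set.ncard_coe_finset]
  refine Finset.card_biUnion_le.trans (le_of_eq ?_)
  simp [Set.ncard_eq_toFinset_card']

theorem sum_ncard_inter_le [Finite V] [Fintype ι] (hd : ∀ i j, ∀ a ∈ A i, a ∈ A j → i = j)
    (Y : Set V) : ∑ i, (Y ∩ A i).ncard ≤ Y.ncard := by
  have := Fintype.ofFinite V
  simp only [Set.ncard_eq_toFinset_card']
  rw [← Finset.card_biUnion]
  · refine Finset.card_le_card fun x hx => ?_
    simp only [Finset.mem_biUnion, Set.mem_toFinset] at hx ⊢
    exact hx.choose_spec.2.1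
  · intro i _ j _ hij
    rw [Function.onFun, Finset.disjoint_left]
    intro x hx hx'
    simp only [Set.mem_toFinset] at hx hx'
    exact hij (hd i j x hx.2 hx'.2)

theorem optF_iUnion_le [Finite V] [Fintype ι] (hF : ∀ H ∈ F, H.adj.Connected)
    (hA : ∀ i j, ∀ a ∈ A i, ∀ b ∈ A j, G.Adj a b → i = j) :
    optF F G (⋃ i, A i) ≤ ∑ i, optF F G (A i) := by
  choose Y hY hYc using fun i => exists_fDelSetOn_ncard_eq (G := G) (A := A i) hF
  refine (optF_le (FDelSetOn.iUnion hF hA hY)).trans ((ncard_iUnion_le_sum Y).trans ?_)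
  simp [hYc]

/-- Local embeddings of the parts of a disjoint union combine to a local embedding of the union,
provided each part can be sent to itself or has at least `M` possible targets. -/
theorem LocalEmb.iUnion {M : ℕ} {Z : Set L} {S S' : ι → Set V} {J : ι → Finset ι}
    (hA : ∀ i j, ∀ a ∈ A i, ∀ b ∈ A j, G.Adj a b → i = j)
    (hd : ∀ i j, ∀ a ∈ A i, a ∈ A j → i = j) (hS : ∀ i, S i ⊆ A i) (hS' : ∀ i, S' i ⊆ A i)
    (hJ : ∀ i, M ≤ (J i).card ∨ i ∈ J i)
    (h : ∀ i, ∀ j ∈ J i, LocalEmb G lab M Z (S i) (S' j)) :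
    LocalEmb G lab M Z (⋃ i, S i) (⋃ i, S' i) := by
  intro U hU hUM
  rcases U.eq_empty_or_nonempty with rfl | ⟨u₀, hu₀⟩
  · exact ⟨id, by simp⟩
  have hc : ∀ u, ∃ i, u ∈ U → u ∈ S i := by
    intro u
    by_cases hu : u ∈ U
    · obtain ⟨i, hi⟩ := Set.mem_iUnion.1 (hU hu)
      exact ⟨i, fun _ => hi⟩
    · obtain ⟨i, _⟩ := Set.mem_iUnion.1 (hU hu₀)
      exact ⟨i, fun h => absurd h hu⟩
  choose c hc using hc
  let I : Finset ι := U.image c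
  have hI : ∀ u, u ∈ U → c u ∈ I := fun u hu => Finset.mem_image_of_mem c hu
  obtain ⟨σ, hσ, hσJ⟩ := (Finset.all_card_le_biUnion_card_iff_exists_injective
    (fun i : I => J i)).1 (by
      intro s
      by_cases hs : ∃ i ∈ s, M ≤ (J i).card
      · obtain ⟨i, hi, hMi⟩ := hs
        calc s.card ≤ Fintype.card I := s.card_le_univ
          _ = I.card := Fintype.card_coe I
          _ ≤ M := Finset.card_image_le.trans hUM
          _ ≤ _ := hMi.trans (Finset.card_le_card
            (Finset.subset_biUnion_of_mem (fun i : I => J i) hi))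
      · push Not at hs
        rw [← Finset.card_image_of_injective s Subtype.val_injective]
        refine Finset.card_le_card fun x hx => ?_
        obtain ⟨i, hi, rfl⟩ := Finset.mem_image.1 hx
        exact Finset.mem_biUnion.2 ⟨i, hi, (hJ i).resolve_left (hs i hi).not_ge⟩)
  choose f f1 f2 f3 f4 using fun i : I => h i (σ i) (hσJ i) (U.filter (c · = i))
    (fun u hu => by
      obtain ⟨hu, hi⟩ := Finset.mem_filter.1 (Finset.mem_coe.1 hu)
      exact hi ▸ hc u hu)
    ((Finset.card_filter_le _ _).trans hUM)
  let k : V → V := fun u => if hu : u ∈ U then f ⟨c u, hI u hu⟩ u else u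
  have hk : ∀ u, ∀ hu : u ∈ U, k u = f ⟨c u, hI u hu⟩ u := fun u hu => dif_pos hu
  have hkS : ∀ u, ∀ hu : u ∈ U, k u ∈ S' (σ ⟨c u, hI u hu⟩) := fun u hu => by
    rw [hk u hu]
    exact f1 _ u (by simp [hu])
  refine ⟨k, fun u hu => Set.mem_iUnion_of_mem _ (hkS u hu), ?_, ?_, ?_⟩
  · intro u hu w hw huw
    have e1 := hkS u hu
    rw [huw] at e1
    have e2 := hσ (hd _ _ _ (hS' _ e1) (hS' _ (hkS w hw)))
    have e3 : c u = c w := congrArg Subtype.val e2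
    rw [hk u hu, hk w hw, ← e2] at huw
    exact f2 ⟨c u, hI u hu⟩ (by simpa using hu) (by simpa [e3] using hw) huw
  · intro u hu w hw huw
    have e3 : c u = c w := hA _ _ u (hS _ (hc u hu)) w (hS _ (hc w hw)) huw
    have e2 : (⟨c u, hI u hu⟩ : I) = ⟨c w, hI w hw⟩ := Subtype.ext e3
    rw [hk u hu, hk w hw, ← e2]
    exact f3 _ u (by simp [hu]) w (by simp [hw, e3]) huw
  · intro u hu z hz hzu
    rw [hk u hu]
    exact f4 _ u (by simp [hu]) z hz hzu

/-- A small set of representatives containing many members of every class it does not exhaust. -/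
theorem exists_representatives [Fintype ι] {κ : Type*} [Fintype κ] (r : ι → κ) (K : ℕ) :
    ∃ S : Finset ι, S.card ≤ Fintype.card κ * K ∧
      ∀ i, i ∉ S → K ≤ (S.filter fun j => r j = r i).card := by
  have h : ∀ k, ∃ T ⊆ Finset.univ.filter (fun j => r j = k), T.card ≤ K ∧
      (T.card = K ∨ T = Finset.univ.filter fun j => r j = k) := by
    intro k
    rcases le_total K (Finset.univ.filter fun j => r j = k).card with h | h
    · obtain ⟨T, hT, hTc⟩ := Finset.exists_subset_card_eq h
      exact ⟨T, hT, hTc.le, Or.inl hTc⟩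
    · exact ⟨_, subset_rfl, h, Or.inr rfl⟩
  choose T hT hTK hTe using h
  refine ⟨Finset.univ.biUnion T, Finset.card_biUnion_le_card_mul _ _ _ fun k _ => hTK k, ?_⟩
  intro i hi
  have hi' : i ∉ T (r i) := fun h => hi (Finset.mem_biUnion.2 ⟨_, Finset.mem_univ _, h⟩)
  have hK : (T (r i)).card = K := (hTe (r i)).resolve_right fun h => hi' (by simp [h])
  rw [← hK]
  refine Finset.card_le_card fun j hj => Finset.mem_filter.2 ⟨?_, ?_⟩
  · exact Finset.mem_biUnion.2 ⟨_, Finset.mem_univ _, hj⟩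
  · simpa using hT _ hj

/-- Bound on the size of the subfamily needed for a disjoint union. -/
def unionBound (M e ζ B : ℕ) : ℕ :=
  2 ^ ((e + 1) * patternBound M ζ) * ((e + 1) * patternBound M ζ * (M + e + 1)) *
    ((e + 1) * patternBound M ζ * B)

theorem SmallObstruction.iUnion [Finite V] [Finite ι] (hF : ∀ H ∈ F, H.adj.Connected)
    (hA : ∀ i j, ∀ a ∈ A i, ∀ b ∈ A j, G.Adj a b → i = j)
    (hd : ∀ i j, ∀ a ∈ A i, a ∈ A j → i = j) {M e θ N ζ B : ℕ}
    (h : ∀ i, SmallObstruction F G lab (A i) M e θ N ζ B) :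
    SmallObstruction F G lab (⋃ i, A i) M e θ N ζ (unionBound M e ζ B) := by
  have := Fintype.ofFinite ι
  intro Z X Q P b hZ hQc hQN hQl hQs hP hb hQ
  let T := Fin (e + 1) × Set (Pattern M Z)
  have hT : Fintype.card T ≤ (e + 1) * patternBound M ζ := by
    simp only [T, Fintype.card_prod, Fintype.card_fin]
    exact Nat.mul_le_mul_left _ (card_set_pattern_le hZ)
  let R : ι → Set T := fun i => {x | ∃ Y, FDelSetOn F G (A i) Y ∧
    Y.ncard ≤ optF F G (A i) + x.1 ∧ patterns G lab M Z (A i \ Y) ⊆ x.2 ∧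
    ∀ q ∈ Q, ¬ HasLabMinor G lab q (A i \ Y)}
  have hE : ∀ i, ∀ x : T, ∃ Qs : Finset (LabGraph L), ↑Qs ⊆ Q ∧ Qs.card ≤ B ∧ (x ∉ R i →
      ∀ Y, FDelSetOn F G (A i) Y → Y.ncard ≤ optF F G (A i) + x.1 →
      patterns G lab M Z (A i \ Y) ⊆ x.2 → ∃ q ∈ Qs, HasLabMinor G lab q (A i \ Y)) := by
    intro i x
    by_cases hx : x ∈ R i
    · exact ⟨∅, by simp, by simp, fun h => absurd hx h⟩
    obtain ⟨Qs, h1, h2, h3⟩ := h i Z X Q (fun S => patterns G lab M Z S ⊆ x.2)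
      (optF F G (A i) + x.1) hZ hQc hQN hQl hQs
      (fun S _ S' _ hSS hS' => (patterns_subset_iff.2 hSS).trans hS')
      (by have := x.1.2; omega)
      (fun Y hY hYb hYp => by
        by_contra! hno
        exact hx ⟨Y, hY, hYb, hYp, hno⟩)
    exact ⟨Qs, h1, h2, fun _ => h3⟩
  choose E hEQ hEc hE using hE
  obtain ⟨S, hSc, hS⟩ := exists_representatives R ((e + 1) * patternBound M ζ * (M + e + 1))
  refine ⟨S.biUnion fun i => Finset.univ.biUnion (E i), ?_, ?_, ?_⟩
  · intro q hq
    simp only [Finset.coe_biUnion, Set.mem_iUnion] at hq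
    obtain ⟨i, _, x, _, hq⟩ := hq
    exact hEQ i x hq
  · refine (Finset.card_biUnion_le_card_mul _ _ _ fun i _ =>
      Finset.card_biUnion_le_card_mul _ _ B fun x _ => hEc i x).trans ?_
    unfold unionBound
    refine Nat.mul_le_mul (hSc.trans (Nat.mul_le_mul_right _ ?_)) (Nat.mul_le_mul_right _ hT)
    rw [Fintype.card_set]
    exact Nat.pow_le_pow_right (by norm_num) hT
  intro Y hY hYb hPY
  by_contra! hno
  have hYi : ∀ i, FDelSetOn F G (A i) (Y ∩ A i) := fun i => hY.inter (Set.subset_iUnion A i)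
  let ex : ι → ℕ := fun i => (Y ∩ A i).ncard - optF F G (A i)
  have hex : ∀ i, (Y ∩ A i).ncard = optF F G (A i) + ex i := fun i =>
    (Nat.add_sub_cancel' (optF_le (hYi i))).symm
  have hsum : ∑ i, ex i ≤ e := by
    have h1 := sum_ncard_inter_le hd Y
    have h2 := optF_iUnion_le (ι := ι) hF hA
    simp only [hex, Finset.sum_add_distrib] at h1
    omega
  have hexe : ∀ i, ex i < e + 1 := fun i => Nat.lt_succ_of_le
    ((Finset.single_le_sum (fun j _ => Nat.zero_le (ex j)) (Finset.mem_univ i)).trans hsum)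
  let x : ι → T := fun i => (⟨ex i, hexe i⟩, patterns G lab M Z (A i \ (Y ∩ A i)))
  have hxR : ∀ i ∈ S, x i ∈ R i := by
    intro i hi
    by_contra hxi
    obtain ⟨q, hq, hm⟩ := hE i (x i) hxi (Y ∩ A i) (hYi i) (hex i).le subset_rfl
    refine hno q ?_ (hm.mono ?_)
    · simp only [Finset.mem_biUnion, Finset.mem_univ, true_and]
      exact ⟨i, hi, x i, hq⟩
    · exact fun y hy => ⟨Set.mem_iUnion_of_mem i hy.1, fun h => hy.2 ⟨h, hy.1⟩⟩
  have key : ∀ i, ∃ Y', ∃ J : Finset ι, FDelSetOn F G (A i) Y' ∧ Y'.ncard ≤ (Y ∩ A i).ncard ∧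
      (∀ q ∈ Q, ¬ HasLabMinor G lab q (A i \ Y')) ∧ (M ≤ J.card ∨ i ∈ J) ∧
      ∀ j ∈ J, LocalEmb G lab M Z (A i \ Y') (A j \ (Y ∩ A j)) := by
    intro i
    by_cases hi : i ∈ S
    · obtain ⟨Y', h1, h2, h3, h4⟩ := hxR i hi
      refine ⟨Y', {i}, h1, h2.trans (hex i).ge, h4, Or.inr (Finset.mem_singleton_self i), ?_⟩
      intro j hj
      rw [Finset.mem_singleton.1 hj]
      exact patterns_subset_iff.1 h3
    · obtain ⟨y, _, hy⟩ := Finset.exists_le_card_fiber_of_mul_le_card_of_maps_to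
        (s := S.filter fun j => R j = R i) (t := Finset.univ) (f := x) (n := M + e + 1)
        (fun _ _ => Finset.mem_univ _) ⟨x i, Finset.mem_univ _⟩
        ((Nat.mul_le_mul_right _ hT).trans (hS i hi))
      set J := (S.filter fun j => R j = R i).filter fun j => x j = y with hJ
      have mJ : ∀ {j}, j ∈ J → j ∈ S ∧ R j = R i ∧ x j = y := fun hj => by
        simpa [hJ, and_assoc] using hj
      obtain ⟨j₀, hj₀⟩ : J.Nonempty := Finset.card_pos.1 (by omega)
      have hexJ : ∀ j ∈ J, ex j = y.1 := fun j hj => by rw [← (mJ hj).2.2]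
      have hy0 : (y.1 : ℕ) = 0 := by
        by_contra hy0
        have h1 : ∑ j ∈ J, ex j ≤ e :=
          (Finset.sum_le_sum_of_subset (Finset.subset_univ J)).trans hsum
        rw [Finset.sum_congr rfl hexJ, Finset.sum_const, smul_eq_mul] at h1
        have := Nat.le_mul_of_pos_right J.card (Nat.pos_of_ne_zero hy0)
        omega
      have hyR : y ∈ R i := by
        rw [← (mJ hj₀).2.1, ← (mJ hj₀).2.2]
        exact hxR j₀ (mJ hj₀).1
      obtain ⟨Y', h1, h2, h3, h4⟩ := hyR
      refine ⟨Y', J, h1, ?_, h4, Or.inl (by omega), ?_⟩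
      · have := hex i
        omega
      · intro j hj
        refine patterns_subset_iff.1 (h3.trans ?_)
        rw [← (mJ hj).2.2]
  choose Y' J h1 h2 h3 h4 h5 using key
  have hd1 : ∀ C : ι → Set V, (∀ i, C i ⊆ A i) →
      (⋃ i, A i) \ (⋃ i, C i) = ⋃ i, A i \ C i := by
    intro C hC
    ext y
    simp only [Set.mem_sdiff, Set.mem_iUnion, not_exists]
    constructor
    · rintro ⟨⟨i, hi⟩, hy⟩
      exact ⟨i, hi, hy i⟩
    · rintro ⟨i, hi, hy⟩
      exact ⟨⟨i, hi⟩, fun j hj => hy (hd i j y hi (hC j hj) ▸ hj)⟩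
  have hYU : (⋃ i, Y ∩ A i) = Y := by
    rw [← Set.inter_iUnion, Set.inter_eq_left]
    exact hY.1
  have hY' := FDelSetOn.iUnion hF hA h1
  have hY'b : (⋃ i, Y' i).ncard ≤ b := (ncard_iUnion_le_sum Y').trans
    ((Finset.sum_le_sum fun i _ => h2 i).trans ((sum_ncard_inter_le hd Y).trans hYb))
  obtain ⟨q, hq, hm⟩ := hQ _ hY' hY'b (by
    refine hP _ Set.sdiff_subset _ Set.sdiff_subset ?_ hPY
    rw [hd1 _ fun i => (h1 i).1]
    have e1 := hd1 (fun i => Y ∩ A i) fun i => Set.inter_subset_right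
    rw [hYU] at e1
    rw [e1]
    exact LocalEmb.iUnion hA hd (fun i => Set.sdiff_subset) (fun i => Set.sdiff_subset) h4 h5)
  obtain ⟨i, hi⟩ := hm.exists_part (hQc q hq) Set.sdiff_subset hA
  exact h3 i q hq (hi.mono fun y hy => ⟨hy.2, fun h => hy.1.2 (Set.mem_iUnion_of_mem i h)⟩)

end Union

section Main

theorem IsCompOf.eq {V : Type*} {G : SimpleGraph V} {S C C' : Set V} {a b : V}
    (hC : IsCompOf G S C) (hC' : IsCompOf G S C') (ha : a ∈ C) (hb : b ∈ C')
    (hab : ReachIn G S a b) : C = C' := by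
  obtain ⟨v, hv, rfl⟩ := hC
  obtain ⟨v', hv', rfl⟩ := hC'
  have h : ReachIn G S v v' := (ha.2.trans hab).trans hb.2.symm
  ext w
  exact ⟨fun hw => ⟨hw.1, h.symm.trans hw.2⟩, fun hw => ⟨hw.1, h.trans hw.2⟩⟩

theorem iUnion_isCompOf {V : Type*} (G : SimpleGraph V) (S : Set V) :
    ⋃ C : {C // IsCompOf G S C}, (C : Set V) = S := by
  ext a
  simp only [Set.mem_iUnion]
  constructor
  · rintro ⟨⟨_, v, hv, rfl⟩, ha⟩
    exact ha.1
  · exact fun ha => ⟨⟨_, a, ha, rfl⟩, ha, ReachIn.refl a⟩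

theorem exists_smallObstruction {F : Set FinGraph} (hFfin : F.Finite)
    (hF : ∀ H ∈ F, H.adj.Connected) (n : ℕ) : ∀ M e θ N ζ, ∃ B, ∀ (V L : Type) [Finite V]
      (G : SimpleGraph V) (lab : V → Set L) (nb : V → L), (∀ u w, nb w ∈ lab u ↔ G.Adj u w) →
      ∀ A, tdLE G n A → SmallObstruction F G lab A M e θ N ζ B := by
  obtain ⟨K, hK⟩ := (hFfin.image FinGraph.n).bddAbove
  induction n with
  | zero =>
    intro M e θ N ζ
    refine ⟨0, ?_⟩
    rintro V L _ G lab nb hnb A rfl Z X Q P b _ hQc _ _ _ _ _ hQ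
    refine ⟨∅, by simp, by simp, fun Y hY hYb hPY => ?_⟩
    obtain ⟨q, hq, hm⟩ := hQ Y hY hYb hPY
    exact absurd (hm.mono Set.sdiff_subset) (not_hasLabMinor_empty (hQc q hq))
  | succ n ih =>
    intro M e θ N ζ
    obtain ⟨B₀, h₀⟩ := ih M e θ N ζ
    obtain ⟨B₁, h₁⟩ := ih (certBound M (N + K) (ζ + θ) (reachBound n)) (e + 1) θ (N + 1)
      (ζ + θ + 1)
    refine ⟨unionBound M e ζ (B₀ + branchBound B₁ (labGraphBound N (ζ + θ)) θ), ?_⟩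
    intro V L _ G lab nb hnb A hA
    rw [← iUnion_isCompOf G A]
    refine SmallObstruction.iUnion hF ?_ ?_ ?_
    · intro C C' a ha b hb hab
      refine Subtype.ext (C.2.eq C'.2 ha hb (ReachIn.single hab ?_ ?_)) <;>
        rw [← iUnion_isCompOf G A]
      exacts [Set.mem_iUnion_of_mem C ha, Set.mem_iUnion_of_mem C' hb]
    · exact fun C C' a ha ha' => Subtype.ext (C.2.eq C'.2 ha ha' (ReachIn.refl a))
    · rintro ⟨C, hC⟩
      obtain ⟨v, hv, hn⟩ := hA C hC
      have h := SmallObstruction.insert_root hF (fun H hH => hK ⟨H, hH, rfl⟩) hnb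
        (by simp : v ∉ C \ {v}) (shortReach_of_tdLE n _ hn) (h₀ V L G lab nb hnb _ hn)
        (h₁ V L G lab nb hnb _ hn)
      rwa [Set.insert_sdiff_singleton, Set.insert_eq_of_mem hv] at h

theorem isOptFDel_iff {V : Type} {F : Set FinGraph} (hF : ∀ H ∈ F, H.adj.Connected)
    {G : SimpleGraph V} {Y : Set V} :
    IsOptFDel F G Y ↔ FDelSetOn F G Set.univ Y ∧ Y.ncard ≤ optF F G Set.univ := by
  refine and_congr_right fun _ => ⟨fun h => ?_, fun h Y' hY' => h.trans (optF_le hY')⟩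
  obtain ⟨Y', hY', hc⟩ := exists_fDelSetOn_ncard_eq (G := G) (A := Set.univ) hF
  exact hc ▸ h Y' hY'

/-- The graph `q` with its labels transported along `Sum.inr`. -/
def LabGraph.inr {X : Type} (α : Type) (q : LabGraph X) : LabGraph (α ⊕ X) :=
  ⟨q.n, q.adj, fun w => Sum.inr '' q.lab w⟩

theorem LabGraph.inr_injective {X α : Type} :
    Function.Injective (LabGraph.inr α : LabGraph X → LabGraph (α ⊕ X)) := by
  rintro ⟨n, adj, lab⟩ ⟨n', adj', lab'⟩ h
  simp only [LabGraph.inr, LabGraph.mk.injEq] at h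
  obtain ⟨rfl, h1, h2⟩ := h
  rw [eq_of_heq h1]
  congr
  funext w
  exact Sum.inr_injective.image_injective (congrFun (eq_of_heq h2) w)

/-- Add to the labels of each vertex its set of neighbours. -/
def adjLabels {V X : Type} (G : SimpleGraph V) (lab : V → Set X) (u : V) : Set (V ⊕ X) :=
  Sum.inl '' G.neighborSet u ∪ Sum.inr '' lab u

theorem inl_mem_adjLabels {V X : Type} {G : SimpleGraph V} {lab : V → Set X} (u w : V) :
    Sum.inl w ∈ adjLabels G lab u ↔ G.Adj u w := by
  simp [adjLabels]

theorem hasLabMinor_inr {V X : Type} {G : SimpleGraph V} {lab : V → Set X} {q : LabGraph X}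
    {S : Set V} : HasLabMinor G (adjLabels G lab) (q.inr V) S ↔ HasLabMinor G lab q S := by
  constructor
  · rintro ⟨φ, h⟩
    refine ⟨φ, h.sub, h.nonempty, h.conn, h.disj, h.edge, fun w x hx => ?_⟩
    obtain ⟨a, ha, hxa⟩ := h.labels w (Sum.inr x) ⟨x, hx, rfl⟩
    exact ⟨a, ha, by simpa [adjLabels] using hxa⟩
  · rintro ⟨φ, h⟩
    refine ⟨φ, h.sub, h.nonempty, h.conn, h.disj, h.edge, ?_⟩
    rintro w _ ⟨x, hx, rfl⟩
    obtain ⟨a, ha, hxa⟩ := h.labels w x hx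
    exact ⟨a, ha, by simpa [adjLabels] using hxa⟩

end Main

/-- **Main lemma.** Let `F` be a finite nonempty set of connected graphs.
Then there is a bound `g : ℕ → ℕ` (depending on `F` alone) such that the following holds.
Let `X` be a finite set of labels, let `C` be an `X`-labeled graph (a finite graph `C` with
labels `labC`), and let `Q` be a `(min_{H∈F} |V(H)|)`-saturated set of connected `X`-labeled
graphs, each on at most `max_{H∈F} |E(H)| + 1` vertices.  If every optimal `F`-deletion set
`Y` of `C` leaves a `Q`-minor (i.e. `C − Y` has a labeled `Q`-minor), then there is
`Q* ⊆ Q` with `|Q*| ≤ g(td(C))` such that every optimal `F`-deletion set of `C` leaves a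
`Q*`-minor. -/
theorem stmt2 (F : Set FinGraph) (hFfin : F.Finite) (hFne : F.Nonempty)
    (hFconn : ∀ H ∈ F, H.adj.Connected) :
    ∃ g : ℕ → ℕ,
      ∀ (X V : Type) (_ : Finite X) (_ : Fintype V)
        (C : SimpleGraph V) (labC : V → Set X) (Q : Set (LabGraph X)),
        (∀ q ∈ Q, q.adj.Connected) →
        (∀ q ∈ Q, q.n ≤ sSup {m | ∃ H ∈ F, m = H.adj.edgeSet.ncard} + 1) →
        (∀ X' : Set X, X'.ncard = sInf {m | ∃ H ∈ F, m = H.n} →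
          (⟨1, ⊥, fun _ => X'⟩ : LabGraph X) ∈ Q) →
        (∀ Y : Set V, IsOptFDel F C Y →
          ∃ q ∈ Q, ∃ φ, IsLabMinorModelOn q C labC Yᶜ φ) →
        ∃ Qs ⊆ Q, Qs.ncard ≤ g (treedepth C) ∧
          ∀ Y : Set V, IsOptFDel F C Y →
            ∃ q ∈ Qs, ∃ φ, IsLabMinorModelOn q C labC Yᶜ φ := by
  choose B hB using fun n => exists_smallObstruction hFfin hFconn n 0 0
    (sInf {m | ∃ H ∈ F, m = H.n}) (sSup {m | ∃ H ∈ F, m = H.adj.edgeSet.ncard} + 1) 0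
  refine ⟨B, fun X V _ _ C labC Q hQc hQN hQs hQ => ?_⟩
  simp only [isOptFDel_iff hFconn, Set.compl_eq_univ_sdiff] at hQ ⊢
  obtain ⟨Qs, hQsQ, hQsc, hQsm⟩ := hB (treedepth C) V (V ⊕ X) C (adjLabels C labC) Sum.inl
    inl_mem_adjLabels Set.univ (tdLE_treedepth C) ∅ (Set.range Sum.inr) (LabGraph.inr V '' Q)
    (fun _ => True) (optF F C Set.univ) (by simp) (by rintro _ ⟨q, hq, rfl⟩; exact hQc q hq)
    (by rintro _ ⟨q, hq, rfl⟩; exact hQN q hq)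
    (by
      rintro _ ⟨q, hq, rfl⟩ w
      exact (Set.image_subset_range _ _).trans Set.subset_union_right)
    (by
      intro W hW hWc
      have e1 : Sum.inr '' (Sum.inr ⁻¹' (W : Set (V ⊕ X)) : Set X) = (W : Set (V ⊕ X)) :=
        Set.image_preimage_eq_of_subset hW
      refine ⟨_, hQs (Sum.inr ⁻¹' (W : Set (V ⊕ X))) ?_, ?_⟩
      · rw [← Set.ncard_image_of_injective _ (Sum.inr_injective (α := V)), e1,
          Set.ncard_coe_finset, hWc]
      · simp only [LabGraph.inr, LabGraph.single, e1])
    (fun _ _ _ _ _ h => h) le_rfl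
    (by
      intro Y hY hYb _
      obtain ⟨q, hq, hm⟩ := hQ Y ⟨hY, hYb⟩
      exact ⟨q.inr V, ⟨q, hq, rfl⟩, hasLabMinor_inr.2 hm⟩)
  obtain ⟨Q', hQ', rfl⟩ := Finset.subset_set_image_iff.1 hQsQ
  rw [Finset.card_image_of_injective _ LabGraph.inr_injective] at hQsc
  refine ⟨Q', hQ', (Set.ncard_coe_finset Q').trans_le hQsc, fun Y hY => ?_⟩
  obtain ⟨_, hq, hm⟩ := hQsm Y hY.1 hY.2 trivial
  obtain ⟨q, hqQ, rfl⟩ := Finset.mem_image.1 hq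
  exact ⟨q, hqQ, hasLabMinor_inr.1 hm⟩

end

end FDel
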